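/- arXiv:1802.04026 — 2 statements merged into one kernel-verified Lean document; each statement's English description precedes it below -/
import Mathlib

section
/- Let a₁, a₂ ∈ H^∞ be outer functions. Then a₁/a₂ ∈ H^∞ if and only if T_{\bar{a₁}} H^2 ⊆ T_{\bar{a₂}} H^2. -/
open Complex Set

noncomputable section

/-- The open unit disk in `ℂ`. -/
def unitDisk : Set ℂ := Metric.ball 0 1

/-- The `n`-th Taylor coefficient of `f` at `0`. -/
def coef (f : ℂ → ℂ) (n : ℕ) : ℂ := iteratedDeriv n f 0 / (n.factorial : ℂ)

/-- `f` belongs to the Hardy space `H²` of the unit disk. -/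
def MemH2 (f : ℂ → ℂ) : Prop :=
  DifferentiableOn ℂ f unitDisk ∧ Summable fun n => ‖coef f n‖ ^ 2

/-- The `H²` norm. -/
def norm2 (f : ℂ → ℂ) : ℝ := Real.sqrt (∑' n, ‖coef f n‖ ^ 2)

/-- The `H²` inner product. -/
def inner2 (f g : ℂ → ℂ) : ℂ := ∑' n, coef f n * (starRingEnd ℂ) (coef g n)

/-- `f` belongs to `H^∞`: bounded and analytic on the unit disk. -/
def MemHinf (f : ℂ → ℂ) : Prop :=
  DifferentiableOn ℂ f unitDisk ∧ ∃ C, ∀ z ∈ unitDisk, ‖f z‖ ≤ C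

/-- The `H^∞` (sup) norm. -/
def normInf (f : ℂ → ℂ) : ℝ := sSup ((fun z => ‖f z‖) '' unitDisk)

/-- The co-analytic Toeplitz operator `T_{\bar a}` in terms of Taylor
coefficients: the `n`-th coefficient of `T_{\bar a} f` is
`∑ₖ conj (â k) * f̂ (n + k)`. -/
def Tbar (a f : ℂ → ℂ) : ℂ → ℂ :=
  fun z => ∑' n : ℕ, (∑' k : ℕ, (starRingEnd ℂ) (coef a k) * coef f (n + k)) * z ^ n

/-- Membership in the range space `M(ā) = T_{\bar a} H²` (as functions on the disk). -/
def MemMbar (a g : ℂ → ℂ) : Prop :=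
  ∃ f, MemH2 f ∧ Set.EqOn g (Tbar a f) unitDisk

/-- The range norm on `M(ā)`: `‖T_{\bar a} f‖_{ā} = ‖f‖_{H²}`. -/
def normMbar (a g : ℂ → ℂ) : ℝ :=
  sInf {r | ∃ f, MemH2 f ∧ Set.EqOn g (Tbar a f) unitDisk ∧ r = norm2 f}

/-- `a` is outer: the analytic Toeplitz operator `T_a` (multiplication by `a`)
has dense range in `H²`. -/
def Outer (a : ℂ → ℂ) : Prop :=
  ∀ g, MemH2 g → ∀ ε > 0, ∃ f, MemH2 f ∧ norm2 (fun z => g z - a z * f z) < ε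

/-- `u` is inner: multiplication by `u` is isometric on `H²`. -/
def IsInner (u : ℂ → ℂ) : Prop :=
  MemHinf u ∧ ∀ f, MemH2 f → norm2 (fun z => u z * f z) = norm2 f

/-- `p` is (given by) a polynomial of degree `< N`, i.e. of degree at most `N - 1`. -/
def MemPoly (N : ℕ) (p : ℂ → ℂ) : Prop :=
  ∃ q : Polynomial ℂ, q.degree < (N : WithBot ℕ) ∧ ∀ z, p z = q.eval z

/-- `φ` is a multiplier from `M(ā₁)` to `M(ā₂)`. -/
def Mult (a₁ a₂ φ : ℂ → ℂ) : Prop :=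
  DifferentiableOn ℂ φ unitDisk ∧
    ∀ f, MemMbar a₁ f → MemMbar a₂ fun z => φ z * f z

/-- The backward shift `B f = (f - f 0) / z`. -/
def Bshift (f : ℂ → ℂ) : ℂ → ℂ :=
  fun z => if z = 0 then deriv f 0 else (f z - f 0) / z

open scoped InnerProductSpace

/-- A function given on the disk by a convergent power series has that series as Taylor series. -/
theorem coef_eq_of_hasSum {f : ℂ → ℂ} {c : ℕ → ℂ}
    (h : ∀ z ∈ unitDisk, HasSum (fun n => c n * z ^ n) (f z)) :
    DifferentiableOn ℂ f unitDisk ∧ coef f = c := by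
  have hp : HasFPowerSeriesOnBall f (FormalMultilinearSeries.ofScalars ℂ c) 0 1 := by
    refine ⟨?_, one_pos, ?_⟩
    · refine ENNReal.le_of_forall_nnreal_lt fun r hr => ?_
      have hr1 : (r : ℝ) < 1 := by exact_mod_cast hr
      have hs := (h (r : ℂ) (by simpa [unitDisk] using hr1)).summable
      refine FormalMultilinearSeries.le_radius_of_tendsto _ (l := 0) ?_
      have := hs.norm.tendsto_atTop_zero
      simpa [FormalMultilinearSeries.ofScalars_norm] using this
    · intro y hy
      have hy' : y ∈ unitDisk := by
        rw [unitDisk, ← Metric.eball_ofReal]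
        simpa using hy
      simpa [FormalMultilinearSeries.ofScalars_apply_eq, mul_comm] using h y hy'
  refine ⟨?_, ?_⟩
  · have := hp.differentiableOn
    rw [unitDisk, ← Metric.eball_ofReal]
    simpa using this
  · ext n
    have := hp.factorial_smul 1 n
    rw [coef, iteratedDeriv_eq_iteratedFDeriv, ← this,
      FormalMultilinearSeries.ofScalars_apply_eq, nsmul_eq_mul]
    have : (n.factorial : ℂ) ≠ 0 := by exact_mod_cast n.factorial_ne_zero
    simp [mul_div_cancel_left₀ _ this]

theorem hasSum_coef {f : ℂ → ℂ} (hf : DifferentiableOn ℂ f unitDisk) {z : ℂ}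
    (hz : z ∈ unitDisk) : HasSum (fun n => coef f n * z ^ n) (f z) := by
  convert! Complex.hasSum_taylorSeries_on_ball hf hz using 2 with n
  simp only [coef, smul_eq_mul, sub_zero]
  ring

theorem mul_fourier_one_mem_unitDisk {r : ℝ} (hr0 : 0 ≤ r) (hr1 : r < 1)
    (θ : AddCircle (1 : ℝ)) : (r * fourier 1 θ : ℂ) ∈ unitDisk := by
  rw [unitDisk, mem_ball_zero_iff, norm_mul, fourier_apply, Circle.norm_coe, mul_one,
    Complex.norm_of_nonneg hr0]
  exact hr1

theorem Orthonormal.norm_sum_smul_sq {𝕜 ι E : Type*} [RCLike 𝕜] [NormedAddCommGroup E]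
    [InnerProductSpace 𝕜 E] {v : ι → E} (hv : Orthonormal 𝕜 v) (c : ι → 𝕜) (s : Finset ι) :
    ‖∑ i ∈ s, c i • v i‖ ^ 2 = ∑ i ∈ s, ‖c i‖ ^ 2 := by
  have h := hv.inner_sum c c s
  simp only [RCLike.conj_mul, inner_self_eq_norm_sq_to_K] at h
  exact_mod_cast h

/-- Parseval's identity on the circle of radius `r < 1`. -/
theorem hasSum_sq_circle {f : ℂ → ℂ} (hf : DifferentiableOn ℂ f unitDisk) {r : ℝ}
    (hr0 : 0 ≤ r) (hr1 : r < 1) :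
    ∃ F : C(AddCircle (1 : ℝ), ℂ), (∀ θ, F θ = f (r * fourier 1 θ)) ∧
      HasSum (fun n => ‖coef f n * (r : ℂ) ^ n‖ ^ 2)
        (‖F.toLp 2 AddCircle.haarAddCircle ℂ‖ ^ 2) := by
  have hrd : (r : ℂ) ∈ unitDisk := by simpa [unitDisk, abs_of_nonneg hr0] using hr1
  have hs : Summable fun n : ℕ =>
      (coef f n * (r : ℂ) ^ n) • (fourier (n : ℤ) : C(AddCircle (1 : ℝ), ℂ)) := by
    refine Summable.of_norm ?_
    simpa [norm_smul, fourier_norm] using (hasSum_coef hf hrd).summable.norm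
  refine ⟨∑' n : ℕ, (coef f n * (r : ℂ) ^ n) • (fourier (n : ℤ) : C(AddCircle (1 : ℝ), ℂ)),
    fun θ => ?_, ?_⟩
  · have h1 := (ContinuousMap.evalCLM ℂ θ).hasSum hs.hasSum
    refine h1.unique ?_
    convert! hasSum_coef hf (mul_fourier_one_mem_unitDisk hr0 hr1 θ) using 2 with n
    have : fourier (n : ℤ) θ = fourier 1 θ ^ n := by
      simp only [fourier_apply, one_zsmul, natCast_zsmul, AddCircle.toCircle_nsmul, Circle.coe_pow]
    simp [this, mul_pow, mul_assoc]
  · have h1 := (ContinuousMap.toLp 2 (AddCircle.haarAddCircle (T := (1 : ℝ))) ℂ).hasSum hs.hasSum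
    have ho : Orthonormal ℂ fun n : ℕ => (fourierLp (T := (1 : ℝ)) 2 (n : ℤ)) :=
      orthonormal_fourier.comp _ Nat.cast_injective
    have h2 := (h1.norm.pow 2)
    refine Filter.Tendsto.congr (fun s => ?_) h2
    simp only [map_smul]
    exact ho.norm_sum_smul_sq (fun n : ℕ => coef f n * (r : ℂ) ^ n) s

theorem hasSum_norm_sq (x : lp (fun _ : ℕ => ℂ) 2) : HasSum (fun n => ‖x n‖ ^ 2) (‖x‖ ^ 2) := by
  simpa using lp.hasSum_norm (p := 2) (by simp) x

/-- The sequence of Taylor coefficients of a function in `H²`. -/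
def ofH2 (f : ℂ → ℂ) (hf : MemH2 f) : lp (fun _ : ℕ => ℂ) 2 :=
  ⟨coef f, memℓp_gen (by simpa using hf.2)⟩

/-- The function on the disk with the given Taylor coefficients. -/
def toH2 (x : lp (fun _ : ℕ => ℂ) 2) : ℂ → ℂ := fun z => ∑' n, x n * z ^ n

/-- The Cauchy kernel at a point of the disk. -/
def cauchyKernel (z : ℂ) (hz : z ∈ unitDisk) : lp (fun _ : ℕ => ℂ) 2 :=
  ⟨fun n => (starRingEnd ℂ z) ^ n, memℓp_gen (by
    have h : ‖z‖ < 1 := by simpa [unitDisk] using hz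
    have := summable_geometric_of_lt_one (sq_nonneg ‖z‖) (by nlinarith [norm_nonneg z])
    simpa [← pow_mul, mul_comm] using this)⟩

theorem hasSum_toH2_inner (x : lp (fun _ : ℕ => ℂ) 2) {z : ℂ} (hz : z ∈ unitDisk) :
    HasSum (fun n => x n * z ^ n) ⟪cauchyKernel z hz, x⟫_ℂ := by
  convert! lp.hasSum_inner (𝕜 := ℂ) (cauchyKernel z hz) x using 2 with n
  simp [cauchyKernel, mul_comm]

theorem toH2_eq_inner (x : lp (fun _ : ℕ => ℂ) 2) {z : ℂ} (hz : z ∈ unitDisk) :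
    toH2 x z = ⟪cauchyKernel z hz, x⟫_ℂ :=
  (hasSum_toH2_inner x hz).tsum_eq

theorem hasSum_toH2 (x : lp (fun _ : ℕ => ℂ) 2) {z : ℂ} (hz : z ∈ unitDisk) :
    HasSum (fun n => x n * z ^ n) (toH2 x z) :=
  toH2_eq_inner x hz ▸ hasSum_toH2_inner x hz

theorem toH2_add (x y : lp (fun _ : ℕ => ℂ) 2) {z : ℂ} (hz : z ∈ unitDisk) :
    toH2 (x + y) z = toH2 x z + toH2 y z := by
  simp only [toH2_eq_inner _ hz, inner_add_right]

theorem toH2_smul (c : ℂ) (x : lp (fun _ : ℕ => ℂ) 2) {z : ℂ} (hz : z ∈ unitDisk) :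
    toH2 (c • x) z = c * toH2 x z := by
  simp only [toH2_eq_inner _ hz, inner_smul_right]

theorem coef_toH2 (x : lp (fun _ : ℕ => ℂ) 2) : coef (toH2 x) = x :=
  (coef_eq_of_hasSum fun _ hz => hasSum_toH2 x hz).2

theorem memH2_toH2 (x : lp (fun _ : ℕ => ℂ) 2) : MemH2 (toH2 x) :=
  ⟨(coef_eq_of_hasSum fun _ hz => hasSum_toH2 x hz).1,
    by simpa [coef_toH2] using (hasSum_norm_sq x).summable⟩

theorem ofH2_toH2 (x : lp (fun _ : ℕ => ℂ) 2) : ofH2 (toH2 x) (memH2_toH2 x) = x :=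
  Subtype.ext (coef_toH2 x)

theorem toH2_ofH2 {f : ℂ → ℂ} (hf : MemH2 f) {z : ℂ} (hz : z ∈ unitDisk) :
    toH2 (ofH2 f hf) z = f z :=
  (hasSum_coef hf.1 hz).tsum_eq

theorem toH2_injOn {x y : lp (fun _ : ℕ => ℂ) 2} (h : Set.EqOn (toH2 x) (toH2 y) unitDisk) :
    x = y := by
  refine Subtype.ext ?_
  rw [← coef_toH2 x]
  exact (coef_eq_of_hasSum fun z hz => h hz ▸ hasSum_toH2 y hz).2

/-- A bounded analytic function multiplies `H²` into itself. -/
theorem mul_memH2 {a : ℂ → ℂ} (had : DifferentiableOn ℂ a unitDisk) {C : ℝ}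
    (hC : ∀ z ∈ unitDisk, ‖a z‖ ≤ C) (x : lp (fun _ : ℕ => ℂ) 2) :
    ∃ h : MemH2 (fun z => a z * toH2 x z), ‖ofH2 _ h‖ ≤ C * ‖x‖ := by
  have hC0 : 0 ≤ C := (norm_nonneg _).trans (hC 0 (by simp [unitDisk]))
  have hd : DifferentiableOn ℂ (fun z => a z * toH2 x z) unitDisk := had.mul (memH2_toH2 x).1
  have key : ∀ s : Finset ℕ, ∑ n ∈ s, ‖coef (fun z => a z * toH2 x z) n‖ ^ 2 ≤ (C * ‖x‖) ^ 2 := by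
    intro s
    have hr : ∀ r : ℝ, 0 ≤ r → r < 1 →
        ∑ n ∈ s, ‖coef (fun z => a z * toH2 x z) n * (r : ℂ) ^ n‖ ^ 2 ≤ (C * ‖x‖) ^ 2 := by
      intro r hr0 hr1
      obtain ⟨F, hF, hFs⟩ := hasSum_sq_circle (memH2_toH2 x).1 hr0 hr1
      obtain ⟨G, hG, hGs⟩ := hasSum_sq_circle hd hr0 hr1
      have h1 : ‖F.toLp 2 AddCircle.haarAddCircle ℂ‖ ^ 2 ≤ ‖x‖ ^ 2 := by
        refine hasSum_le (fun n => ?_) hFs (hasSum_norm_sq x)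
        rw [coef_toH2, norm_mul, norm_pow]
        have : ‖(r : ℂ)‖ ^ n ≤ 1 := pow_le_one₀ (norm_nonneg _)
          (by simpa [abs_of_nonneg hr0] using hr1.le)
        gcongr
        exact mul_le_of_le_one_right (norm_nonneg _) this
      have h2 : ‖G.toLp 2 AddCircle.haarAddCircle ℂ‖ ≤
          C * ‖F.toLp 2 AddCircle.haarAddCircle ℂ‖ := by
        refine MeasureTheory.Lp.norm_le_mul_norm_of_ae_le_mul ?_
        filter_upwards [F.coeFn_toLp (𝕜 := ℂ) (p := 2) AddCircle.haarAddCircle,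
          G.coeFn_toLp (𝕜 := ℂ) (p := 2) AddCircle.haarAddCircle] with θ h3 h4
        rw [h3, h4, hF, hG, norm_mul]
        gcongr
        exact hC _ (mul_fourier_one_mem_unitDisk hr0 hr1 θ)
      refine (sum_le_hasSum s (fun _ _ => by positivity) hGs).trans ?_
      have h3 := abs_le_of_sq_le_sq' h1 (norm_nonneg _)
      gcongr
      exact h2.trans (mul_le_mul_of_nonneg_left h3.2 hC0)
    have ht : Filter.Tendsto (fun r : ℝ =>
        ∑ n ∈ s, ‖coef (fun z => a z * toH2 x z) n * (r : ℂ) ^ n‖ ^ 2) (nhdsWithin 1 (Set.Iio 1))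
        (nhds (∑ n ∈ s, ‖coef (fun z => a z * toH2 x z) n * ((1 : ℝ) : ℂ) ^ n‖ ^ 2)) :=
      (Continuous.tendsto (by fun_prop) 1).mono_left nhdsWithin_le_nhds
    have := le_of_tendsto ht (by
      filter_upwards [Ioo_mem_nhdsLT (zero_lt_one (α := ℝ))] with r h
      exact hr r h.1.le h.2)
    simpa using this
  refine ⟨⟨hd, summable_of_sum_le (fun _ => by positivity) key⟩, ?_⟩
  refine abs_le_of_sq_le_sq' ?_ (by positivity) |>.2
  exact hasSum_le_of_sum_le (hasSum_norm_sq _) key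

/-- The analytic Toeplitz operator: multiplication by a bounded analytic function,
acting on coefficient sequences. -/
def mulOp (a : ℂ → ℂ) (ha : MemHinf a) :
    lp (fun _ : ℕ => ℂ) 2 →L[ℂ] lp (fun _ : ℕ => ℂ) 2 :=
  LinearMap.mkContinuous
    { toFun := fun x => ofH2 _ (mul_memH2 ha.1 ha.2.choose_spec x).1
      map_add' := fun x y => toH2_injOn fun z hz => by
        simp only [toH2_add _ _ hz, toH2_ofH2 _ hz, mul_add]
      map_smul' := fun c x => toH2_injOn fun z hz => by
        simp only [toH2_smul _ _ hz, toH2_ofH2 _ hz, RingHom.id_apply, mul_left_comm] }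
    ha.2.choose fun x => (mul_memH2 ha.1 ha.2.choose_spec x).2

theorem toH2_mulOp {a : ℂ → ℂ} (ha : MemHinf a) (x : lp (fun _ : ℕ => ℂ) 2) {z : ℂ}
    (hz : z ∈ unitDisk) : toH2 (mulOp a ha x) z = a z * toH2 x z :=
  toH2_ofH2 (mul_memH2 ha.1 ha.2.choose_spec x).1 hz

theorem toH2_single (n : ℕ) : toH2 (lp.single 2 n 1) = fun z => z ^ n := by
  ext z
  rw [toH2, tsum_eq_single n]
  · simp
  · intro m hm
    simp [hm]

theorem coe_mulOp_single {a : ℂ → ℂ} (ha : MemHinf a) (n : ℕ) :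
    ⇑(mulOp a ha (lp.single 2 n 1)) = fun m => if n ≤ m then coef a (m - n) else 0 := by
  rw [← coef_toH2]
  refine (coef_eq_of_hasSum fun z hz => ?_).2
  rw [toH2_mulOp ha _ hz, toH2_single]
  rw [← hasSum_nat_add_iff' n]
  rw [Finset.sum_eq_zero (fun i hi => by simp [Finset.mem_range.1 hi]), sub_zero]
  convert! (hasSum_coef ha.1 hz).mul_right (z ^ n) using 2 with m
  simp [pow_add, mul_assoc]

theorem adjoint_mulOp_apply {a : ℂ → ℂ} (ha : MemHinf a) (x : lp (fun _ : ℕ => ℂ) 2) (n : ℕ) :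
    (ContinuousLinearMap.adjoint (mulOp a ha) x) n =
      ∑' k : ℕ, (starRingEnd ℂ) (coef a k) * x (n + k) := by
  have h1 := lp.inner_single_left (𝕜 := ℂ) n (1 : ℂ) (ContinuousLinearMap.adjoint (mulOp a ha) x)
  rw [ContinuousLinearMap.adjoint_inner_right] at h1
  have h2 := lp.hasSum_inner (𝕜 := ℂ) (mulOp a ha (lp.single 2 n 1)) x
  rw [h1, coe_mulOp_single, ← hasSum_nat_add_iff' n,
    Finset.sum_eq_zero (fun i hi => by simp [Finset.mem_range.1 hi]), sub_zero] at h2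
  have h3 : ⟪(1 : ℂ), ContinuousLinearMap.adjoint (mulOp a ha) x n⟫_ℂ =
      ContinuousLinearMap.adjoint (mulOp a ha) x n := by simp
  rw [h3] at h2
  rw [← h2.tsum_eq]
  congr 1
  ext k
  simp [add_comm, mul_comm]

theorem Tbar_eq {a f : ℂ → ℂ} (ha : MemHinf a) (hf : MemH2 f) :
    Tbar a f = toH2 (ContinuousLinearMap.adjoint (mulOp a ha) (ofH2 f hf)) := by
  ext z
  simp only [Tbar, toH2, adjoint_mulOp_apply]
  rfl

theorem memMbar_toH2_iff {a : ℂ → ℂ} (ha : MemHinf a) {y : lp (fun _ : ℕ => ℂ) 2} :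
    MemMbar a (toH2 y) ↔ ∃ x, ContinuousLinearMap.adjoint (mulOp a ha) x = y := by
  constructor
  · rintro ⟨f, hf, h⟩
    rw [Tbar_eq ha hf] at h
    exact ⟨_, (toH2_injOn h).symm⟩
  · rintro ⟨x, rfl⟩
    refine ⟨toH2 x, memH2_toH2 x, ?_⟩
    rw [Tbar_eq ha (memH2_toH2 x), ofH2_toH2]
    exact fun _ _ => rfl

/-- Multiplication operators are multiplicative in the symbol. -/
theorem mulOp_mulOp {a b c : ℂ → ℂ} (ha : MemHinf a) (hb : MemHinf b) (hc : MemHinf c)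
    (h : ∀ z ∈ unitDisk, a z = b z * c z) : mulOp a ha = mulOp c hc ∘L mulOp b hb := by
  ext1 x
  refine toH2_injOn fun z hz => ?_
  rw [ContinuousLinearMap.comp_apply, toH2_mulOp _ _ hz, toH2_mulOp _ _ hz, toH2_mulOp _ _ hz,
    h z hz]
  ring

theorem mulOp_comm {a b : ℂ → ℂ} (ha : MemHinf a) (hb : MemHinf b)
    (x : lp (fun _ : ℕ => ℂ) 2) :
    mulOp a ha (mulOp b hb x) = mulOp b hb (mulOp a ha x) :=
  toH2_injOn fun z hz => by
    rw [toH2_mulOp _ _ hz, toH2_mulOp _ _ hz, toH2_mulOp _ _ hz, toH2_mulOp _ _ hz, mul_left_comm]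

theorem toH2_iterate_mulOp {a : ℂ → ℂ} (ha : MemHinf a) (n : ℕ) (x : lp (fun _ : ℕ => ℂ) 2)
    {z : ℂ} (hz : z ∈ unitDisk) : toH2 ((mulOp a ha)^[n] x) z = a z ^ n * toH2 x z := by
  induction n with
  | zero => simp
  | succ n ih => rw [Function.iterate_succ_apply', toH2_mulOp _ _ hz, ih, pow_succ', mul_assoc]

theorem Outer.denseRange_mulOp {a : ℂ → ℂ} (ha : MemHinf a) (ho : Outer a) :
    DenseRange (mulOp a ha) := by
  refine Metric.denseRange_iff.2 fun x ε hε => ?_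
  obtain ⟨f, hf, hn⟩ := ho (toH2 x) (memH2_toH2 x) ε hε
  refine ⟨ofH2 f hf, ?_⟩
  have hc : coef (fun z => toH2 x z - a z * f z) = ⇑(x - mulOp a ha (ofH2 f hf)) := by
    refine (coef_eq_of_hasSum fun z hz => ?_).2
    have := (hasSum_toH2 x hz).sub (hasSum_toH2 (mulOp a ha (ofH2 f hf)) hz)
    rw [toH2_mulOp _ _ hz, toH2_ofH2 _ hz] at this
    convert! this using 2 with n
    simp [sub_mul]
  rw [dist_eq_norm]
  rwa [norm2, hc, (hasSum_norm_sq _).tsum_eq, Real.sqrt_sq (norm_nonneg _)] at hn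

/-- The norm inequality of Douglas' range inclusion lemma. -/
theorem exists_norm_le_of_range_adjoint_subset {𝕜 E F G : Type*} [RCLike 𝕜]
    [NormedAddCommGroup E] [InnerProductSpace 𝕜 E] [CompleteSpace E]
    [NormedAddCommGroup F] [InnerProductSpace 𝕜 F] [CompleteSpace F]
    [NormedAddCommGroup G] [InnerProductSpace 𝕜 G] [CompleteSpace G]
    (A : E →L[𝕜] F) (B : E →L[𝕜] G)
    (h : ∀ y, ∃ w, ContinuousLinearMap.adjoint B w = ContinuousLinearMap.adjoint A y) :
    ∃ C : ℝ, 0 ≤ C ∧ ∀ x, ‖A x‖ ≤ C * ‖B x‖ := by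
  choose w hw using h
  have hin : ∀ x y, ⟪A x, y⟫_𝕜 = ⟪B x, w y⟫_𝕜 := fun x y => by
    rw [← ContinuousLinearMap.adjoint_inner_right, ← hw, ContinuousLinearMap.adjoint_inner_right]
  obtain ⟨C, hC⟩ := banach_steinhaus (g := fun x => innerSL 𝕜 ((‖B x‖⁻¹ : 𝕜) • A x))
    (fun y => ⟨‖w y‖, fun x => by
      rw [innerSL_apply_apply, inner_smul_left, hin, norm_mul]
      rcases eq_or_ne (‖B x‖) 0 with h0 | h0
      · simp [h0]
      · have := norm_inner_le_norm (𝕜 := 𝕜) (B x) (w y)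
        have hpos : 0 < ‖B x‖ := by positivity
        rw [show ‖(starRingEnd 𝕜) (‖B x‖⁻¹ : 𝕜)‖ = ‖B x‖⁻¹ by simp]
        rwa [inv_mul_le_iff₀ hpos]⟩)
  have hC0 : 0 ≤ C := (norm_nonneg _).trans (hC 0)
  refine ⟨C, hC0, fun x => ?_⟩
  rcases eq_or_ne (‖B x‖) 0 with h0 | h0
  · have : A x = 0 := by
      rw [← inner_self_eq_zero (𝕜 := 𝕜), hin, norm_eq_zero.1 h0, inner_zero_left]
    simp [this, h0]
  · have hpos : 0 < ‖B x‖ := by positivity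
    have := hC x
    rw [innerSL_apply_norm, norm_smul, norm_inv, RCLike.norm_ofReal, abs_norm,
      inv_mul_le_iff₀ hpos] at this
    rwa [mul_comm]

theorem le_of_forall_pow_le_const_mul_pow {s t M : ℝ} (h : ∀ n : ℕ, s ^ n ≤ M * t ^ n)
    (ht : 0 ≤ t) : s ≤ t := by
  by_contra! hlt
  have hs' : 0 < s := ht.trans_lt hlt
  rcases ht.eq_or_lt with rfl | ht'
  · have := h 1
    norm_num at this
    linarith
  obtain ⟨n, hn⟩ := pow_unbounded_of_one_lt M ((one_lt_div ht').2 hlt)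
  rw [div_pow, lt_div_iff₀ (by positivity)] at hn
  exact absurd (h n) (not_le.2 hn)

/-- Domination of the multiplication operators gives pointwise domination of the symbols. -/
theorem norm_le_of_norm_mulOp_le {a b : ℂ → ℂ} (ha : MemHinf a) (hb : MemHinf b)
    (hd : DenseRange (mulOp b hb)) {C : ℝ} (hC0 : 0 ≤ C)
    (hC : ∀ x, ‖mulOp a ha x‖ ≤ C * ‖mulOp b hb x‖) {z : ℂ} (hz : z ∈ unitDisk) :
    b z ≠ 0 ∧ ‖a z‖ ≤ C * ‖b z‖ := by
  have hiter : ∀ n x, ‖(mulOp a ha)^[n] x‖ ≤ C ^ n * ‖(mulOp b hb)^[n] x‖ := by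
    intro n
    induction n with
    | zero => simp
    | succ n ih =>
      intro x
      have hc : (mulOp b hb) ((mulOp a ha)^[n] x) = (mulOp a ha)^[n] (mulOp b hb x) :=
        Function.Commute.iterate_right (fun y => mulOp_comm hb ha y) n x
      calc ‖(mulOp a ha)^[n + 1] x‖ ≤ C * ‖(mulOp b hb) ((mulOp a ha)^[n] x)‖ := by
            rw [Function.iterate_succ_apply']; exact hC _
        _ ≤ C * (C ^ n * ‖(mulOp b hb)^[n] (mulOp b hb x)‖) := by
            rw [hc]; gcongr; exact ih _
        _ = C ^ (n + 1) * ‖(mulOp b hb)^[n + 1] x‖ := by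
            rw [Function.iterate_succ_apply]; ring
  have hdn : ∀ n, DenseRange (mulOp b hb)^[n] := by
    intro n
    induction n with
    | zero => exact denseRange_id
    | succ n ih =>
      rw [Function.iterate_succ]
      exact ih.comp hd ((mulOp b hb).continuous.iterate n)
  set K := ‖cauchyKernel z hz‖
  have heval : ∀ x, ‖toH2 x z‖ ≤ K * ‖x‖ := fun x => by
    rw [toH2_eq_inner x hz]; exact norm_inner_le_norm _ _
  set e : lp (fun _ : ℕ => ℂ) 2 := lp.single 2 0 1
  have he : toH2 e z = 1 := by simp [e, toH2_single]
  have hK0 : 0 ≤ K := norm_nonneg _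
  have happrox : ∀ n, ∃ x, 1 / 2 ≤ ‖b z‖ ^ n * ‖toH2 x z‖ ∧
      ‖(mulOp b hb)^[n] x‖ ≤ ‖e‖ + 1 := by
    intro n
    obtain ⟨x, hx⟩ := Metric.denseRange_iff.1 (hdn n) e (1 / (2 * (K + 1))) (by positivity)
    rw [dist_eq_norm] at hx
    refine ⟨x, ?_, ?_⟩
    · have h1 := heval (e - (mulOp b hb)^[n] x)
      have h2 : K * ‖e - (mulOp b hb)^[n] x‖ ≤ 1 / 2 := by
        calc _ ≤ (K + 1) * (1 / (2 * (K + 1))) := by gcongr; linarith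
          _ = 1 / 2 := by field_simp
      rw [toH2_eq_inner _ hz, inner_sub_right, ← toH2_eq_inner, ← toH2_eq_inner, he,
        toH2_iterate_mulOp _ _ _ hz] at h1
      have h3 := norm_sub_norm_le (1 : ℂ) (b z ^ n * toH2 x z)
      rw [norm_one, norm_mul, norm_pow] at h3
      linarith
    · have h1 := norm_sub_norm_le ((mulOp b hb)^[n] x) e
      rw [norm_sub_rev] at h1
      have : 1 / (2 * (K + 1)) ≤ 1 := by
        rw [div_le_one (by positivity)]; linarith
      linarith
  have hb0 : b z ≠ 0 := by
    intro h0
    obtain ⟨x, hx, -⟩ := happrox 1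
    norm_num [h0] at hx
  refine ⟨hb0, ?_⟩
  have hbpos : 0 < ‖b z‖ := norm_pos_iff.2 hb0
  have hpow : ∀ n, (‖a z‖) ^ n ≤ (2 * (K * (‖e‖ + 1))) * (C * ‖b z‖) ^ n := by
    intro n
    obtain ⟨x, hx1, hx2⟩ := happrox n
    have h1 := heval ((mulOp a ha)^[n] x)
    rw [toH2_iterate_mulOp _ _ _ hz, norm_mul, norm_pow] at h1
    have h2 : ‖a z‖ ^ n * ‖toH2 x z‖ ≤ K * (C ^ n * (‖e‖ + 1)) :=
      h1.trans (mul_le_mul_of_nonneg_left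
        ((hiter n x).trans (mul_le_mul_of_nonneg_left hx2 (by positivity))) hK0)
    calc ‖a z‖ ^ n ≤ ‖a z‖ ^ n * (2 * (‖b z‖ ^ n * ‖toH2 x z‖)) :=
          le_mul_of_one_le_right (by positivity) (by linarith)
      _ = 2 * ‖b z‖ ^ n * (‖a z‖ ^ n * ‖toH2 x z‖) := by ring
      _ ≤ 2 * ‖b z‖ ^ n * (K * (C ^ n * (‖e‖ + 1))) := by gcongr
      _ = _ := by rw [mul_pow]; ring
  exact le_of_forall_pow_le_const_mul_pow hpow (by positivity)

/-- for outer `a₁, a₂ ∈ H^∞`, one has `a₁/a₂ ∈ H^∞` if and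
only if `T_{\bar{a₁}} H² ⊆ T_{\bar{a₂}} H²`. -/
theorem stmt3 (a₁ a₂ : ℂ → ℂ) (h₁ : MemHinf a₁) (h₂ : MemHinf a₂)
    (ho₁ : Outer a₁) (ho₂ : Outer a₂) :
    (∃ h, MemHinf h ∧ ∀ z ∈ unitDisk, a₁ z = a₂ z * h z) ↔
      ∀ g, MemMbar a₁ g → MemMbar a₂ g := by
  constructor
  · rintro ⟨h, hh, hfac⟩ g ⟨f, hf, hg⟩
    rw [Tbar_eq h₁ hf, mulOp_mulOp h₁ h₂ hh hfac, ContinuousLinearMap.adjoint_comp] at hg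
    obtain ⟨f', hf', hg'⟩ := (memMbar_toH2_iff h₂).2 ⟨_, rfl⟩
    exact ⟨f', hf', hg.trans hg'⟩
  · intro hsub
    obtain ⟨C, hC0, hC⟩ := exists_norm_le_of_range_adjoint_subset (𝕜 := ℂ) (mulOp a₁ h₁)
      (mulOp a₂ h₂) fun y => (memMbar_toH2_iff h₂).1 (hsub _ ((memMbar_toH2_iff h₁).2 ⟨y, rfl⟩))
    have key := fun z (hz : z ∈ unitDisk) =>
      norm_le_of_norm_mulOp_le h₁ h₂ (ho₂.denseRange_mulOp h₂) hC0 hC hz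
    refine ⟨fun z => a₁ z / a₂ z, ⟨h₁.1.div h₂.1 fun z hz => (key z hz).1, C, fun z hz => ?_⟩,
      fun z hz => (mul_div_cancel₀ _ (key z hz).1).symm⟩
    rw [norm_div, div_le_iff₀ (norm_pos_iff.2 (key z hz).1)]
    exact (key z hz).2
end
end

section
/- Let a be a polynomial of degree N all of whose zeros lie on the unit circle. Then the set of multipliers of M(\bar{a}) into itself equals M(\bar{a}) ∩ H^∞, i.e. φ ∈ H^∞ with φ ∈ M(\bar{a}) implies φ·f ∈ M(\bar{a}) for every f ∈ M(\bar{a}). -/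
open Complex Set

noncomputable section

open PowerSeries in
/-- The Taylor series of the functions in the Hardy space `H²`. -/
def hardySeries : Submodule ℂ (PowerSeries ℂ) where
  carrier := {F | Summable fun n => ‖coeff n F‖ ^ 2}
  zero_mem' := by simp
  add_mem' {F G} hF hG := by
    refine Summable.of_nonneg_of_le (fun _ => by positivity) (fun n => ?_)
      ((hF.mul_left 2).add (hG.mul_left 2))
    have h := norm_add_le (coeff n F) (coeff n G)
    have h0 := norm_nonneg (coeff n F + coeff n G)
    rw [map_add]
    nlinarith [sq_nonneg (‖coeff n F‖ - ‖coeff n G‖)]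
  smul_mem' c F hF := by
    simpa [mul_pow] using Summable.mul_left (‖c‖ ^ 2) hF

open PowerSeries in
theorem mem_hardySeries {F : PowerSeries ℂ} :
    F ∈ hardySeries ↔ Summable fun n => ‖coeff n F‖ ^ 2 := Iff.rfl

theorem X_mul_mem_hardySeries {F : PowerSeries ℂ} (hF : F ∈ hardySeries) :
    PowerSeries.X * F ∈ hardySeries := by
  rw [mem_hardySeries] at *
  rw [← summable_nat_add_iff 1]
  simpa [PowerSeries.coeff_succ_X_mul] using hF

theorem polynomial_mul_mem_hardySeries (p : Polynomial ℂ) {F : PowerSeries ℂ}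
    (hF : F ∈ hardySeries) : (p : PowerSeries ℂ) * F ∈ hardySeries := by
  induction p using Polynomial.induction_on with
  | C c =>
    rw [Polynomial.coe_C, ← PowerSeries.smul_eq_C_mul]
    exact hardySeries.smul_mem c hF
  | add p q hp hq =>
    rw [Polynomial.coe_add, add_mul]
    exact hardySeries.add_mem hp hq
  | monomial n c h =>
    rw [pow_succ, ← mul_assoc, Polynomial.coe_mul, Polynomial.coe_X, mul_comm _ PowerSeries.X,
      mul_assoc]
    exact X_mul_mem_hardySeries h

theorem one_mem_hardySeries : (1 : PowerSeries ℂ) ∈ hardySeries := by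
  rw [mem_hardySeries, ← summable_nat_add_iff 1]
  simp [PowerSeries.coeff_one]

theorem polynomial_mem_hardySeries (p : Polynomial ℂ) : (p : PowerSeries ℂ) ∈ hardySeries := by
  simpa using polynomial_mul_mem_hardySeries p one_mem_hardySeries

/-- The backward shift on formal power series. -/
def seriesShift : Module.End ℂ (PowerSeries ℂ) where
  toFun F := PowerSeries.mk fun n => PowerSeries.coeff (n + 1) F
  map_add' F G := by ext; simp
  map_smul' c F := by ext; simp

theorem coeff_seriesShift (F : PowerSeries ℂ) (n : ℕ) :
    PowerSeries.coeff n (seriesShift F) = PowerSeries.coeff (n + 1) F := by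
  simp [seriesShift]

theorem seriesShift_mem_hardySeries {F : PowerSeries ℂ} (hF : F ∈ hardySeries) :
    seriesShift F ∈ hardySeries := by
  rw [mem_hardySeries] at *
  simpa only [coeff_seriesShift] using (summable_nat_add_iff 1).2 hF

theorem coeff_seriesShift_pow (k : ℕ) (F : PowerSeries ℂ) (n : ℕ) :
    PowerSeries.coeff n ((seriesShift ^ k) F) = PowerSeries.coeff (n + k) F := by
  induction k generalizing n with
  | zero => simp
  | succ k ih =>
    rw [pow_succ', Module.End.mul_apply, coeff_seriesShift, ih]
    congr 1
    congr 1
    omega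

theorem coeff_aeval_seriesShift (p : Polynomial ℂ) (F : PowerSeries ℂ) (n : ℕ) :
    PowerSeries.coeff n (Polynomial.aeval seriesShift p F) =
      ∑' k, p.coeff k * PowerSeries.coeff (n + k) F := by
  rw [tsum_eq_sum (s := Finset.range (p.natDegree + 1)), Polynomial.aeval_eq_sum_range]
  · simp [LinearMap.sum_apply, coeff_seriesShift_pow]
  · intro k hk
    rw [Polynomial.coeff_eq_zero_of_natDegree_lt (by simpa using hk), zero_mul]

theorem seriesShift_X_mul (F : PowerSeries ℂ) : seriesShift (PowerSeries.X * F) = F := by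
  ext n
  rw [coeff_seriesShift, PowerSeries.coeff_succ_X_mul]

theorem X_mul_seriesShift_add (F : PowerSeries ℂ) :
    PowerSeries.X * seriesShift F + PowerSeries.C (PowerSeries.coeff 0 F) = F := by
  ext n
  cases n <;> simp [PowerSeries.coeff_succ_X_mul, coeff_seriesShift]

theorem seriesShift_coe (p : Polynomial ℂ) :
    seriesShift (p : PowerSeries ℂ) = (p.divX : Polynomial ℂ) := by
  ext n
  simp [coeff_seriesShift, Polynomial.coeff_divX]

theorem degree_divX_lt_of_degree_lt_succ {p : Polynomial ℂ} {n : ℕ} (h : p.degree < (n + 1 : ℕ)) :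
    p.divX.degree < (n : ℕ) := by
  rw [Polynomial.degree_lt_iff_coeff_zero] at *
  intro m hm
  rw [Polynomial.coeff_divX]
  exact h _ (by omega)

theorem exists_divX_sub_C_mul_eq {c : ℂ} (hc : c ≠ 0) (n : ℕ) (Q : Polynomial ℂ)
    (hQ : Q.degree < (n : ℕ)) :
    ∃ q : Polynomial ℂ, q.degree < (n : ℕ) ∧ q.divX - Polynomial.C c * q = Q := by
  induction n generalizing Q with
  | zero =>
    refine ⟨0, by simp, ?_⟩
    have : Q = 0 := by simpa using hQ
    simp [this]
  | succ n ih =>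
    have hd : (-Polynomial.C c⁻¹ * Q).degree < (n + 1 : ℕ) := by
      rw [← Polynomial.C_neg, Polynomial.degree_C_mul (by simpa using hc)]
      exact hQ
    obtain ⟨q, hq, hqe⟩ := ih _ (degree_divX_lt_of_degree_lt_succ hd)
    refine ⟨-Polynomial.C c⁻¹ * Q - q, (Polynomial.degree_sub_le _ _).trans_lt
      (max_lt hd (hq.trans (by exact_mod_cast n.lt_succ_self))), ?_⟩
    have hdiv (u v : Polynomial ℂ) : (u - v).divX = u.divX - v.divX := by
      ext; simp [Polynomial.coeff_divX]
    have h1 : Polynomial.C c * Polynomial.C c⁻¹ = 1 := by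
      rw [← Polynomial.C_mul, mul_inv_cancel₀ hc, Polynomial.C_1]
    rw [hdiv]
    linear_combination -hqe + Q * h1

open Polynomial in
theorem monic_prod_X_sub {N : ℕ} (ζ : Fin N → ℂ) :
    (∏ j, (X - C (ζ j))).Monic ∧ (∏ j, (X - C (ζ j))).natDegree = N := by
  refine ⟨monic_prod_X_sub_C _ _, ?_⟩
  simp

open Polynomial in
theorem exists_aeval_seriesShift_iff {N : ℕ} (ζ : Fin N → ℂ) (hζ : ∀ j, ‖ζ j‖ = 1)
    (G : PowerSeries ℂ) :
    (∃ F ∈ hardySeries,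
      aeval seriesShift (∏ j, (X - C ((starRingEnd ℂ) (ζ j)))) F = G) ↔
    ∃ K ∈ hardySeries, ∃ Q : ℂ[X], Q.degree < (N : ℕ) ∧
      G = (∏ j, (X - C (ζ j)) : ℂ[X]) * K + (Q : PowerSeries ℂ) := by
  induction N generalizing G with
  | zero =>
    constructor
    · rintro ⟨F, hF, h⟩
      exact ⟨F, hF, 0, by simp, by simpa using h.symm⟩
    · rintro ⟨K, hK, Q, hQ, h⟩
      have : Q = 0 := by simpa using hQ
      exact ⟨K, hK, by simp [h, this]⟩
  | succ N ih =>
    obtain ⟨hm, hn⟩ := monic_prod_X_sub (fun j => ζ (Fin.succ j))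
    have hdA := degree_eq_natDegree hm.ne_zero
    rw [hn] at hdA
    replace ih := ih (fun j => ζ j.succ) (fun j => hζ _)
    set A := ∏ j : Fin N, (X - C (ζ j.succ))
    rw [Fin.prod_univ_succ, Fin.prod_univ_succ]
    change _ ↔ ∃ K ∈ hardySeries, ∃ Q : ℂ[X], Q.degree < (N + 1 : ℕ) ∧
      G = ((X - C (ζ 0)) * A : ℂ[X]) * K + (Q : PowerSeries ℂ)
    have hc1 : ζ 0 * (starRingEnd ℂ) (ζ 0) = 1 := by
      rw [Complex.mul_conj, Complex.normSq_eq_norm_sq, hζ]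
      simp
    set w := (starRingEnd ℂ) (ζ 0)
    have hw : w ≠ 0 := right_ne_zero_of_mul_eq_one hc1
    have hC1 : (PowerSeries.C (ζ 0) * PowerSeries.C w : PowerSeries ℂ) = 1 := by
      rw [← map_mul, hc1, map_one]
    have hfac (H : PowerSeries ℂ) :
        aeval seriesShift (X - C w) H = seriesShift H - PowerSeries.C w * H := by
      simp [PowerSeries.smul_eq_C_mul, Module.algebraMap_end_apply]
    have hcoe : (((X - C (ζ 0)) * A : ℂ[X]) : PowerSeries ℂ) =
        (PowerSeries.X - PowerSeries.C (ζ 0)) * (A : PowerSeries ℂ) := by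
      simp [Polynomial.coe_mul, Polynomial.coe_sub]
    have key (K' : PowerSeries ℂ) (q : ℂ[X]) :
        aeval seriesShift (X - C w) (PowerSeries.X * ((A : PowerSeries ℂ) * K') + (q : PowerSeries ℂ)) =
          ((X - C (ζ 0)) * A : ℂ[X]) * (-PowerSeries.C w * K') +
            ((q.divX - C w * q : ℂ[X]) : PowerSeries ℂ) := by
      rw [hfac, map_add, seriesShift_X_mul, seriesShift_coe, hcoe, Polynomial.coe_sub,
        Polynomial.coe_mul, Polynomial.coe_C]
      linear_combination -((A : PowerSeries ℂ) * K') * hC1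
    have hC (c : ℂ) {K : PowerSeries ℂ} (hK : K ∈ hardySeries) :
        PowerSeries.C c * K ∈ hardySeries := by
      rw [← PowerSeries.smul_eq_C_mul]
      exact hardySeries.smul_mem _ hK
    have hCd (c : ℂ) (p : ℂ[X]) : (C c * p).degree ≤ p.degree := by
      rw [← smul_eq_C_mul]
      exact degree_smul_le _ _
    constructor
    · rintro ⟨F, hF, rfl⟩
      rw [map_mul, Module.End.mul_apply]
      obtain ⟨K, hK, Q, hQ, h⟩ := (ih _).1 ⟨F, hF, rfl⟩
      rw [h]
      set c := PowerSeries.coeff 0 K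
      have hq : (C c * A + Q).degree < (N + 1 : ℕ) := by
        refine (degree_add_le _ _).trans_lt (max_lt ?_ (hQ.trans ?_))
        · refine (hCd _ _).trans_lt ?_
          rw [hdA]
          exact_mod_cast N.lt_succ_self
        · exact_mod_cast N.lt_succ_self
      refine ⟨-PowerSeries.C w * seriesShift K, ?_,
        (C c * A + Q).divX - C w * (C c * A + Q), ?_, ?_⟩
      · rw [neg_mul]
        exact hardySeries.neg_mem (hC _ (seriesShift_mem_hardySeries hK))
      · refine (degree_sub_le _ _).trans_lt (max_lt ?_ ?_)
        · exact (degree_divX_lt_of_degree_lt_succ hq).trans (by exact_mod_cast N.lt_succ_self)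
        · exact (hCd _ _).trans_lt hq
      · rw [← key]
        congr 1
        rw [Polynomial.coe_add, Polynomial.coe_mul, Polynomial.coe_C]
        linear_combination -(A : PowerSeries ℂ) * X_mul_seriesShift_add K
    · rintro ⟨K, hK, Q, hQ, rfl⟩
      obtain ⟨q, hq, rfl⟩ := exists_divX_sub_C_mul_eq hw (N + 1) Q hQ
      set K' := -PowerSeries.C (ζ 0) * K with hK'
      set c := q.coeff N
      have hQ2 : (q - C c * A).degree < (N : ℕ) := by
        rw [Polynomial.degree_lt_iff_coeff_zero] at *
        intro m hm'
        rcases hm'.eq_or_lt with rfl | h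
        · have : A.coeff N = 1 := by simpa [Monic, leadingCoeff, hn] using hm
          simp [this, c]
        · have : A.coeff m = 0 := coeff_eq_zero_of_natDegree_lt (by omega)
          simp [this, hq m h]
      obtain ⟨F, hF, hFe⟩ := (ih ((A : PowerSeries ℂ) * (PowerSeries.X * K' + PowerSeries.C c) +
        ((q - C c * A : ℂ[X]) : PowerSeries ℂ))).2 ⟨_, hardySeries.add_mem (X_mul_mem_hardySeries
          (by rw [hK', neg_mul]; exact hardySeries.neg_mem (hC _ hK)))
          (by simpa using hC c one_mem_hardySeries), _, hQ2, rfl⟩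
      refine ⟨F, hF, ?_⟩
      rw [map_mul, Module.End.mul_apply, hFe]
      have : ((A : PowerSeries ℂ) * (PowerSeries.X * K' + PowerSeries.C c) +
        ((q - C c * A : ℂ[X]) : PowerSeries ℂ)) =
          PowerSeries.X * ((A : PowerSeries ℂ) * K') + (q : PowerSeries ℂ) := by
        rw [Polynomial.coe_sub, Polynomial.coe_mul, Polynomial.coe_C]
        ring
      rw [this, key]
      congr 2
      rw [hK']
      linear_combination K * hC1

/-- The continuous function on the circle `AddCircle 1` with Fourier series `∑ c n eⁿ`. -/
def circleSeries (c : ℕ → ℂ) : C(AddCircle (1 : ℝ), ℂ) := ∑' n : ℕ, c n • fourier (n : ℤ)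

theorem hasSum_circleSeries {c : ℕ → ℂ} (hc : Summable fun n => ‖c n‖) :
    HasSum (fun n : ℕ => c n • (fourier (n : ℤ) : C(AddCircle (1 : ℝ), ℂ))) (circleSeries c) := by
  refine (Summable.of_norm ?_).hasSum
  simpa [norm_smul, fourier_norm] using hc

theorem circleSeries_apply {c : ℕ → ℂ} (hc : Summable fun n => ‖c n‖) (x : AddCircle (1 : ℝ)) :
    circleSeries c x = ∑' n, c n * (fourier 1 x) ^ n := by
  refine ((ContinuousMap.evalCLM ℂ x).hasSum (hasSum_circleSeries hc)).tsum_eq.symm.trans ?_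
  refine tsum_congr fun n => ?_
  simp [fourier_apply, AddCircle.toCircle_nsmul]

theorem hasSum_norm_sq_circleSeries {c : ℕ → ℂ} (hc : Summable fun n => ‖c n‖) :
    HasSum (fun n => ‖c n‖ ^ 2)
      (‖ContinuousMap.toLp (E := ℂ) 2 AddCircle.haarAddCircle ℂ (circleSeries c)‖ ^ 2) := by
  have h := (ContinuousMap.toLp (E := ℂ) 2 (AddCircle.haarAddCircle (T := (1 : ℝ))) ℂ).hasSum
    (hasSum_circleSeries hc)
  rw [hasSum_iff_tendsto_nat_of_nonneg (fun n => by positivity)]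
  refine ((h.tendsto_sum_nat.norm).pow 2).congr fun m => ?_
  have ho : Orthonormal ℂ fun n : ℕ => fourierLp (T := (1 : ℝ)) 2 (n : ℤ) :=
    orthonormal_fourier.comp _ Nat.cast_injective
  simp only [map_smul]
  have h2 := ho.inner_sum c c (Finset.range m)
  rw [inner_self_eq_norm_sq_to_K] at h2
  simp only [RCLike.conj_mul] at h2
  exact_mod_cast h2

theorem tsum_norm_sq_le_of_circle_le {c d : ℕ → ℂ} (hc : Summable fun n => ‖c n‖)
    (hd : Summable fun n => ‖d n‖) {C : ℝ}
    (h : ∀ u : ℂ, ‖u‖ = 1 → ‖∑' n, c n * u ^ n‖ ≤ C * ‖∑' n, d n * u ^ n‖) :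
    ∑' n, ‖c n‖ ^ 2 ≤ C ^ 2 * ∑' n, ‖d n‖ ^ 2 := by
  rw [(hasSum_norm_sq_circleSeries hc).tsum_eq, (hasSum_norm_sq_circleSeries hd).tsum_eq,
    ← mul_pow]
  refine pow_le_pow_left₀ (norm_nonneg _) ?_ 2
  refine MeasureTheory.Lp.norm_le_mul_norm_of_ae_le_mul ?_
  filter_upwards [ContinuousMap.coeFn_toLp (p := 2) (𝕜 := ℂ) AddCircle.haarAddCircle
    (circleSeries c), ContinuousMap.coeFn_toLp (p := 2) (𝕜 := ℂ) AddCircle.haarAddCircle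
    (circleSeries d)] with x hx hy
  rw [hx, hy, circleSeries_apply hc, circleSeries_apply hd]
  exact h _ (by rw [fourier_one, Circle.norm_coe])

theorem coeff_mul_mul_pow_eq_sum (F G : PowerSeries ℂ) (z : ℂ) (n : ℕ) :
    PowerSeries.coeff n (F * G) * z ^ n = ∑ kl ∈ Finset.HasAntidiagonal.antidiagonal n,
      (PowerSeries.coeff kl.1 F * z ^ kl.1) * (PowerSeries.coeff kl.2 G * z ^ kl.2) := by
  rw [PowerSeries.coeff_mul, Finset.sum_mul]
  refine Finset.sum_congr rfl fun kl hkl => ?_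
  rw [← Finset.HasAntidiagonal.mem_antidiagonal.1 hkl, pow_add]
  ring

/-- A power series converges absolutely on the open unit disk. -/
def ConvOnDisk (F : PowerSeries ℂ) : Prop :=
  ∀ z : ℂ, ‖z‖ < 1 → Summable fun n => ‖PowerSeries.coeff n F * z ^ n‖

/-- The sum of a power series at a point. -/
def seriesEval (F : PowerSeries ℂ) (z : ℂ) : ℂ := ∑' n, PowerSeries.coeff n F * z ^ n

theorem convOnDisk_of_mem_hardySeries {F : PowerSeries ℂ} (hF : F ∈ hardySeries) :
    ConvOnDisk F := by
  intro z hz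
  have h2 : Summable fun n : ℕ => (‖z‖ ^ 2) ^ n :=
    summable_geometric_of_lt_one (by positivity) (by nlinarith [norm_nonneg z])
  refine Summable.of_nonneg_of_le (fun _ => norm_nonneg _) (fun n => ?_)
    ((mem_hardySeries.1 hF).add h2)
  rw [norm_mul, norm_pow, pow_right_comm]
  nlinarith [sq_nonneg (‖PowerSeries.coeff n F‖ - ‖z‖ ^ n),
    sq_nonneg (‖PowerSeries.coeff n F‖), sq_nonneg (‖z‖ ^ n),
    sq_nonneg (‖PowerSeries.coeff n F‖ + ‖z‖ ^ n)]

theorem convOnDisk_coe (p : Polynomial ℂ) : ConvOnDisk (p : PowerSeries ℂ) :=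
  convOnDisk_of_mem_hardySeries (polynomial_mem_hardySeries p)

theorem ConvOnDisk.mul {F G : PowerSeries ℂ} (hF : ConvOnDisk F) (hG : ConvOnDisk G) :
    ConvOnDisk (F * G) := by
  intro z hz
  refine (summable_norm_sum_mul_antidiagonal_of_summable_norm (hF z hz) (hG z hz)).congr fun n => ?_
  rw [coeff_mul_mul_pow_eq_sum]

theorem seriesEval_add {F G : PowerSeries ℂ} (hF : ConvOnDisk F) (hG : ConvOnDisk G) {z : ℂ}
    (hz : ‖z‖ < 1) : seriesEval (F + G) z = seriesEval F z + seriesEval G z := by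
  simp only [seriesEval, map_add, add_mul]
  exact (hF z hz).of_norm.tsum_add (hG z hz).of_norm

theorem seriesEval_mul {F G : PowerSeries ℂ} (hF : ConvOnDisk F) (hG : ConvOnDisk G) {z : ℂ}
    (hz : ‖z‖ < 1) : seriesEval (F * G) z = seriesEval F z * seriesEval G z := by
  simp only [seriesEval, coeff_mul_mul_pow_eq_sum]
  exact (tsum_mul_tsum_eq_tsum_sum_antidiagonal_of_summable_norm (hF z hz) (hG z hz)).symm

theorem seriesEval_coe (p : Polynomial ℂ) (z : ℂ) :
    seriesEval (p : PowerSeries ℂ) z = p.eval z := by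
  rw [seriesEval, tsum_eq_sum (s := Finset.range (p.natDegree + 1)), Polynomial.eval_eq_sum_range]
  · simp
  · intro k hk
    rw [Polynomial.coeff_coe,
      Polynomial.coeff_eq_zero_of_natDegree_lt (by simpa using hk), zero_mul]

theorem norm_sq_seriesEval_le {F : PowerSeries ℂ} (hF : F ∈ hardySeries) {z : ℂ} (hz : ‖z‖ < 1) :
    ‖seriesEval F z‖ ^ 2 ≤ (∑' n, ‖PowerSeries.coeff n F‖ ^ 2) * (1 - ‖z‖ ^ 2)⁻¹ := by
  have h1 : ‖z‖ ^ 2 < 1 := by nlinarith [norm_nonneg z]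
  have hs := (convOnDisk_of_mem_hardySeries hF z hz).of_norm.hasSum.tendsto_sum_nat
  refine le_of_tendsto (hs.norm.pow 2) (Filter.Eventually.of_forall fun m => ?_)
  calc ‖∑ n ∈ Finset.range m, PowerSeries.coeff n F * z ^ n‖ ^ 2
      ≤ (∑ n ∈ Finset.range m, ‖PowerSeries.coeff n F‖ * ‖z‖ ^ n) ^ 2 := by
        refine pow_le_pow_left₀ (norm_nonneg _) ((norm_sum_le _ _).trans_eq ?_) 2
        simp
    _ ≤ (∑ n ∈ Finset.range m, ‖PowerSeries.coeff n F‖ ^ 2) *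
          ∑ n ∈ Finset.range m, (‖z‖ ^ n) ^ 2 := Finset.sum_mul_sq_le_sq_mul_sq _ _ _
    _ ≤ _ := by
        rw [← tsum_geometric_of_lt_one (by positivity) h1]
        gcongr
        · exact (mem_hardySeries.1 hF).sum_le_tsum _ fun _ _ => by positivity
        · simp only [pow_right_comm _ _ 2]
          exact (summable_geometric_of_lt_one (by positivity) h1).sum_le_tsum _
            fun _ _ => by positivity

theorem ConvOnDisk.hasFPowerSeriesOnBall {F : PowerSeries ℂ} (hF : ConvOnDisk F) :
    HasFPowerSeriesOnBall (seriesEval F)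
      (FormalMultilinearSeries.ofScalars ℂ fun n => PowerSeries.coeff n F) 0 1 := by
  set p := FormalMultilinearSeries.ofScalars ℂ fun n => PowerSeries.coeff n F
  have hr : 1 ≤ p.radius := by
    refine le_of_forall_lt fun r hr => ?_
    obtain ⟨s, hrs, hs⟩ := ENNReal.lt_iff_exists_nnreal_btwn.1 hr
    refine hrs.trans_le (p.le_radius_of_summable_norm ?_)
    have := hF (s : ℝ) (by simpa using hs)
    simpa [p, FormalMultilinearSeries.ofScalars_norm] using this
  have h := (p.hasFPowerSeriesOnBall (one_pos.trans_le hr)).mono one_pos hr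
  refine h.congr fun z _ => ?_
  simp [p, FormalMultilinearSeries.sum, seriesEval, mul_comm]

theorem ConvOnDisk.differentiableOn {F : PowerSeries ℂ} (hF : ConvOnDisk F) :
    DifferentiableOn ℂ (seriesEval F) unitDisk := by
  have := hF.hasFPowerSeriesOnBall.differentiableOn
  rwa [← ENNReal.ofReal_one, Metric.eball_ofReal] at this

theorem ConvOnDisk.coef_seriesEval {F : PowerSeries ℂ} (hF : ConvOnDisk F) (n : ℕ) :
    coef (seriesEval F) n = PowerSeries.coeff n F := by
  have h := hF.hasFPowerSeriesOnBall.factorial_smul 1 n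
  have h0 : (n.factorial : ℂ) ≠ 0 := by exact_mod_cast n.factorial_ne_zero
  rw [coef, div_eq_iff h0, iteratedDeriv_eq_iteratedFDeriv, ← h]
  simp [mul_comm]

theorem coef_congr {f g : ℂ → ℂ} (h : EqOn f g unitDisk) (n : ℕ) : coef f n = coef g n := by
  have : f =ᶠ[nhds 0] g := h.eventuallyEq_of_mem (Metric.ball_mem_nhds 0 one_pos)
  rw [coef, coef, this.iteratedDeriv_eq]

theorem mem_unitDisk {z : ℂ} : z ∈ unitDisk ↔ ‖z‖ < 1 := by simp [unitDisk]

theorem eq_of_seriesEval_eq {F G : PowerSeries ℂ} (hF : ConvOnDisk F) (hG : ConvOnDisk G)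
    (h : ∀ z : ℂ, ‖z‖ < 1 → seriesEval F z = seriesEval G z) : F = G := by
  ext n
  rw [← hF.coef_seriesEval, ← hG.coef_seriesEval]
  exact coef_congr (fun z hz => h z (mem_unitDisk.1 hz)) n

theorem MemH2.exists_series {f : ℂ → ℂ} (hf : MemH2 f) :
    ∃ F ∈ hardySeries, ∀ n, coef f n = PowerSeries.coeff n F :=
  ⟨PowerSeries.mk (coef f), by simpa [mem_hardySeries] using hf.2, fun n => by simp⟩

theorem memH2_seriesEval {F : PowerSeries ℂ} (hF : F ∈ hardySeries) : MemH2 (seriesEval F) := by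
  have h := convOnDisk_of_mem_hardySeries hF
  exact ⟨h.differentiableOn, by simpa [h.coef_seriesEval] using mem_hardySeries.1 hF⟩

open Polynomial in
theorem coe_prod_sub_eq {N : ℕ} (ζ : Fin N → ℂ) :
    (fun z => ∏ j, (z - ζ j)) = seriesEval ((∏ j, (X - C (ζ j)) : ℂ[X]) : PowerSeries ℂ) := by
  ext z
  rw [seriesEval_coe, eval_prod]
  simp

open Polynomial in
theorem Tbar_prod_eq {N : ℕ} (ζ : Fin N → ℂ) {f : ℂ → ℂ} {F : PowerSeries ℂ}
    (hF : ∀ n, coef f n = PowerSeries.coeff n F) :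
    Tbar (fun z => ∏ j, (z - ζ j)) f =
      seriesEval (aeval seriesShift (∏ j, (X - C ((starRingEnd ℂ) (ζ j)))) F) := by
  have hmap : (∏ j, (X - C ((starRingEnd ℂ) (ζ j)))) =
      (∏ j, (X - C (ζ j))).map (starRingEnd ℂ) := by
    simp [Polynomial.map_prod]
  ext z
  rw [coe_prod_sub_eq, Tbar, seriesEval]
  refine tsum_congr fun n => ?_
  rw [coeff_aeval_seriesShift, hmap]
  simp [(convOnDisk_coe _).coef_seriesEval, hF]

open Polynomial in
theorem memMbar_iff {N : ℕ} (ζ : Fin N → ℂ) (hζ : ∀ j, ‖ζ j‖ = 1) (g : ℂ → ℂ) :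
    MemMbar (fun z => ∏ j, (z - ζ j)) g ↔
      ∃ K ∈ hardySeries, ∃ Q : ℂ[X], Q.degree < (N : ℕ) ∧
        EqOn g (seriesEval ((∏ j, (X - C (ζ j)) : ℂ[X]) * K + (Q : PowerSeries ℂ))) unitDisk := by
  constructor
  · rintro ⟨f, hf, hg⟩
    obtain ⟨F, hF, hc⟩ := hf.exists_series
    obtain ⟨K, hK, Q, hQ, h⟩ := (exists_aeval_seriesShift_iff ζ hζ _).1 ⟨F, hF, rfl⟩
    rw [Tbar_prod_eq ζ hc, h] at hg
    exact ⟨K, hK, Q, hQ, hg⟩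
  · rintro ⟨K, hK, Q, hQ, hg⟩
    obtain ⟨F, hF, h⟩ := (exists_aeval_seriesShift_iff ζ hζ _).2 ⟨K, hK, Q, hQ, rfl⟩
    refine ⟨seriesEval F, memH2_seriesEval hF, ?_⟩
    rwa [Tbar_prod_eq ζ (convOnDisk_of_mem_hardySeries hF).coef_seriesEval, h]

/-- Multiplication by a bounded analytic function preserves the Hardy space `H²`. -/
theorem mul_mem_hardySeries_of_bounded {F G : PowerSeries ℂ} (hF : ConvOnDisk F)
    (hG : G ∈ hardySeries) {C : ℝ} (hC : ∀ z : ℂ, ‖z‖ < 1 → ‖seriesEval F z‖ ≤ C) :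
    F * G ∈ hardySeries := by
  have hG' := convOnDisk_of_mem_hardySeries hG
  have hFG := hF.mul hG'
  rw [mem_hardySeries] at *
  have hr (r : ℝ) (hr0 : 0 < r) (hr1 : r < 1) (m : ℕ) :
      ∑ n ∈ Finset.range m, (‖PowerSeries.coeff n (F * G)‖ * r ^ n) ^ 2 ≤
        C ^ 2 * ∑' n, ‖PowerSeries.coeff n G‖ ^ 2 := by
    have hrn : ‖(r : ℂ)‖ < 1 := by simpa [abs_of_pos hr0] using hr1
    have hsq (H : PowerSeries ℂ) (hH : ConvOnDisk H) :
        Summable fun n => ‖PowerSeries.coeff n H * (r : ℂ) ^ n‖ ^ 2 := by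
      refine Summable.of_norm_bounded_eventually_nat (hH r hrn) ?_
      have h0 := (hH r hrn).tendsto_atTop_zero.eventually_le_const one_pos
      filter_upwards [h0] with n hn
      rw [Real.norm_of_nonneg (by positivity)]
      nlinarith [norm_nonneg (PowerSeries.coeff n H * (r : ℂ) ^ n)]
    have h := tsum_norm_sq_le_of_circle_le (hFG r hrn) (hG' r hrn) fun u hu => by
      have hru : ‖(r : ℂ) * u‖ < 1 := by rwa [norm_mul, hu, mul_one]
      have e (H : PowerSeries ℂ) :
          ∑' n, PowerSeries.coeff n H * (r : ℂ) ^ n * u ^ n = seriesEval H (r * u) := by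
        simp [seriesEval, mul_pow, mul_assoc]
      rw [e, e, seriesEval_mul hF hG' hru, norm_mul]
      exact mul_le_mul_of_nonneg_right (hC _ hru) (norm_nonneg _)
    calc ∑ n ∈ Finset.range m, (‖PowerSeries.coeff n (F * G)‖ * r ^ n) ^ 2
        = ∑ n ∈ Finset.range m, ‖PowerSeries.coeff n (F * G) * (r : ℂ) ^ n‖ ^ 2 := by
          simp [abs_of_pos hr0]
      _ ≤ ∑' n, ‖PowerSeries.coeff n (F * G) * (r : ℂ) ^ n‖ ^ 2 :=
          (hsq _ hFG).sum_le_tsum _ fun _ _ => by positivity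
      _ ≤ _ := h
      _ ≤ _ := by
          refine mul_le_mul_of_nonneg_left ((hsq _ hG').tsum_le_tsum (fun n => ?_) hG)
            (by positivity)
          refine pow_le_pow_left₀ (norm_nonneg _) ?_ 2
          rw [norm_mul, norm_pow]
          exact mul_le_of_le_one_right (norm_nonneg _) (pow_le_one₀ (norm_nonneg _) hrn.le)
  refine summable_of_sum_range_le (c := C ^ 2 * ∑' n, ‖PowerSeries.coeff n G‖ ^ 2)
    (fun n => by positivity) fun m => ?_
  have hcont : Continuous fun r : ℝ =>
      ∑ n ∈ Finset.range m, (‖PowerSeries.coeff n (F * G)‖ * r ^ n) ^ 2 := by fun_prop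
  have ht := (hcont.tendsto 1).mono_left (nhdsWithin_le_nhds (s := Iio 1))
  simp only [one_pow, mul_one] at ht
  refine le_of_tendsto ht ?_
  filter_upwards [Ioo_mem_nhdsLT (zero_lt_one' ℝ)] with r h
  exact hr r h.1 h.2 m

/-- A power series that multiplies the Hardy space `H²` into itself is bounded on the disk. -/
theorem exists_bound_of_mul_mem_hardySeries {F : PowerSeries ℂ} (hF : ConvOnDisk F)
    (h : ∀ G ∈ hardySeries, F * G ∈ hardySeries) :
    ∃ C, ∀ z : ℂ, ‖z‖ < 1 → ‖seriesEval F z‖ ≤ C := by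
  have hmem (u : lp (fun _ : ℕ => ℂ) 2) : PowerSeries.mk (u : ℕ → ℂ) ∈ hardySeries := by
    have := (memℓp_gen_iff (by simp)).1 (lp.memℓp u)
    simpa [mem_hardySeries] using this
  have hlp {G : PowerSeries ℂ} (hG : G ∈ hardySeries) :
      Memℓp (fun n => PowerSeries.coeff n G) 2 := by
    rw [memℓp_gen_iff (by simp)]
    simpa [mem_hardySeries] using hG
  let T : lp (fun _ : ℕ => ℂ) 2 →ₗ[ℂ] lp (fun _ : ℕ => ℂ) 2 :=
    { toFun u := ⟨fun n => PowerSeries.coeff n (F * PowerSeries.mk (u : ℕ → ℂ)),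
        hlp (h _ (hmem u))⟩
      map_add' u v := by
        ext n
        simp only [lp.coeFn_add, Pi.add_apply]
        rw [← map_add, ← mul_add]
        rfl
      map_smul' c u := by
        ext n
        simp only [lp.coeFn_smul, Pi.smul_apply, RingHom.id_apply]
        rw [← map_smul, ← mul_smul_comm]
        rfl }
  have hT (u : lp (fun _ : ℕ => ℂ) 2) (n : ℕ) :
      T u n = PowerSeries.coeff n (F * PowerSeries.mk (u : ℕ → ℂ)) := rfl
  have hcoord (n : ℕ) : Continuous fun u : lp (fun _ : ℕ => ℂ) 2 => u n :=
    (lp.evalCLM ℂ (fun _ : ℕ => ℂ) 2 n).continuous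
  have hTc (n : ℕ) : Continuous fun u => T u n := by
    simp only [hT, PowerSeries.coeff_mul, PowerSeries.coeff_mk]
    exact continuous_finsetSum _ fun kl _ => continuous_const.mul (hcoord _)
  let S := ContinuousLinearMap.ofSeqClosedGraph (g := T) fun u x y hx hy => by
    ext n
    exact tendsto_nhds_unique (((hcoord n).tendsto y).comp hy) (((hTc n).tendsto x).comp hx)
  have hS (u : lp (fun _ : ℕ => ℂ) 2) : PowerSeries.mk (S u : ℕ → ℂ) =
      F * PowerSeries.mk (u : ℕ → ℂ) := by
    ext n
    rw [PowerSeries.coeff_mk]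
    exact hT u n
  let e : lp (fun _ : ℕ => ℂ) 2 :=
    ⟨fun n => PowerSeries.coeff n (1 : PowerSeries ℂ), hlp one_mem_hardySeries⟩
  have he : PowerSeries.mk (e : ℕ → ℂ) = 1 := by
    ext n
    rw [PowerSeries.coeff_mk]
  have hpow (k : ℕ) : PowerSeries.mk ((S ^ k) e : ℕ → ℂ) = F ^ k := by
    induction k with
    | zero => simpa using he
    | succ k ih => rw [pow_succ', mul_apply_eq_comp, hS, ih, pow_succ']
  refine ⟨‖S‖, fun z hz => ?_⟩
  have hev (k : ℕ) : ConvOnDisk (F ^ k) ∧ seriesEval (F ^ k) z = seriesEval F z ^ k := by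
    induction k with
    | zero =>
      have := seriesEval_coe 1 z
      have h2 := convOnDisk_coe 1
      rw [Polynomial.coe_one] at this h2
      rw [Polynomial.eval_one] at this
      simpa using ⟨h2, this⟩
    | succ k ih =>
      rw [pow_succ, pow_succ, seriesEval_mul ih.1 hF hz, ih.2]
      exact ⟨ih.1.mul hF, rfl⟩
  have h1 : 0 < 1 - ‖z‖ ^ 2 := by nlinarith [norm_nonneg z]
  have hbound (k : ℕ) : (‖seriesEval F z‖ ^ 2) ^ k ≤
      (‖S‖ ^ 2) ^ k * (‖e‖ ^ 2 * (1 - ‖z‖ ^ 2)⁻¹) := by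
    have hb := norm_sq_seriesEval_le (hmem ((S ^ k) e)) hz
    rw [hpow, (hev k).2, norm_pow, pow_right_comm, ← hpow] at hb
    simp only [PowerSeries.coeff_mk] at hb
    have hn := lp.norm_rpow_eq_tsum (p := 2) (by simp) ((S ^ k) e)
    simp only [ENNReal.toReal_ofNat, Real.rpow_ofNat] at hn
    rw [← hn] at hb
    refine hb.trans ?_
    rw [← mul_assoc]
    refine mul_le_mul_of_nonneg_right ?_ (inv_nonneg.2 h1.le)
    rw [pow_right_comm, ← mul_pow]
    refine pow_le_pow_left₀ (norm_nonneg _) ?_ 2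
    refine ((S ^ k).le_opNorm e).trans (mul_le_mul_of_nonneg_right ?_ (norm_nonneg _))
    rcases k.eq_zero_or_pos with rfl | hk
    · rw [pow_zero, pow_zero]
      exact ContinuousLinearMap.norm_id_le
    · exact norm_pow_le' _ hk
  by_contra! hlt
  have hlt2 : ‖S‖ ^ 2 < ‖seriesEval F z‖ ^ 2 := pow_lt_pow_left₀ hlt (norm_nonneg _) two_ne_zero
  have hpos : 0 < ‖seriesEval F z‖ ^ 2 := (sq_nonneg _).trans_lt hlt2
  have hlim := (tendsto_pow_atTop_nhds_zero_of_lt_one (r := ‖S‖ ^ 2 / ‖seriesEval F z‖ ^ 2)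
    (by positivity) ((div_lt_one hpos).2 hlt2)).mul_const (‖e‖ ^ 2 * (1 - ‖z‖ ^ 2)⁻¹)
  rw [zero_mul] at hlim
  refine absurd (ge_of_tendsto' hlim fun k => ?_) (not_le.2 one_pos)
  rw [div_pow, div_mul_eq_mul_div, one_le_div (by positivity)]
  exact hbound k

open Polynomial in
/-- If a polynomial of degree less than `N` is a product of `∏ (z - ζ j)` with a function that is
`o((1 - r)⁻¹)` along the radii to the points `ζ j`, then it vanishes. -/
theorem eq_zero_of_eval_eq_prod_mul {N : ℕ} (ζ : Fin N → ℂ) (hζ : ∀ j, ‖ζ j‖ = 1)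
    (Q : ℂ[X]) (hQ : Q.degree < (N : ℕ)) (s : ℂ → ℂ)
    (hs : ∀ z : ℂ, ‖z‖ < 1 → Q.eval z = (∏ j, (z - ζ j)) * s z)
    (hlim : ∀ j, Filter.Tendsto (fun r : ℝ => (1 - r : ℂ) * s (r * ζ j)) (nhdsWithin 1 (Iio 1))
      (nhds 0)) : Q = 0 := by
  induction N generalizing Q with
  | zero => simpa using hQ
  | succ N ih =>
    have hroot : Q.IsRoot (ζ 0) := by
      have h1 : Filter.Tendsto (fun r : ℝ => Q.eval ((r : ℂ) * ζ 0)) (nhdsWithin 1 (Iio 1))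
          (nhds (Q.eval (ζ 0))) := by
        have hc : Continuous fun r : ℝ => Q.eval ((r : ℂ) * ζ 0) := by fun_prop
        simpa using (hc.tendsto 1).mono_left (nhdsWithin_le_nhds (s := Iio 1))
      have h2 : Filter.Tendsto (fun r : ℝ => (-ζ 0 * ∏ j : Fin N, ((r : ℂ) * ζ 0 - ζ j.succ)) *
          ((1 - r : ℂ) * s (r * ζ 0))) (nhdsWithin 1 (Iio 1)) (nhds 0) := by
        have hc : Continuous fun r : ℝ =>
          -ζ 0 * ∏ j : Fin N, ((r : ℂ) * ζ 0 - ζ j.succ) := by fun_prop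
        simpa using ((hc.tendsto 1).mono_left (nhdsWithin_le_nhds (s := Iio 1))).mul (hlim 0)
      refine tendsto_nhds_unique h1 (h2.congr' ?_)
      filter_upwards [Ioo_mem_nhdsLT (zero_lt_one' ℝ)] with r hr
      rw [hs _ (by simpa [hζ, abs_of_pos hr.1] using hr.2), Fin.prod_univ_succ]
      ring
    obtain ⟨P, rfl⟩ := dvd_iff_isRoot.2 hroot
    have hP : P.degree < (N : ℕ) := by
      rcases eq_or_ne P 0 with rfl | hP0
      · simp
      · rw [degree_mul, degree_X_sub_C, degree_eq_natDegree hP0] at hQ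
        rw [degree_eq_natDegree hP0]
        norm_cast at hQ ⊢
        omega
    rw [ih (fun j => ζ j.succ) (fun j => hζ _) P hP ?_ fun j => hlim _, mul_zero]
    intro z hz
    have hne : z - ζ 0 ≠ 0 := by
      rw [sub_ne_zero]
      rintro rfl
      exact hz.ne (hζ 0)
    refine mul_left_cancel₀ hne ?_
    have := hs z hz
    rw [Fin.prod_univ_succ] at this
    simpa [mul_assoc] using this

/-- The modulus of an `H²` function is `O((1 - r)^(-1/2))` along radii. -/
theorem one_sub_mul_norm_sq_seriesEval_le {F : PowerSeries ℂ} (hF : F ∈ hardySeries) {u : ℂ}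
    (hu : ‖u‖ = 1) {r : ℝ} (hr0 : 0 < r) (hr1 : r < 1) :
    (1 - r) * ‖seriesEval F (r * u)‖ ^ 2 ≤ ∑' n, ‖PowerSeries.coeff n F‖ ^ 2 := by
  have hn : ‖(r : ℂ) * u‖ = r := by simp [hu, abs_of_pos hr0]
  have h := norm_sq_seriesEval_le hF (z := r * u) (by rwa [hn])
  have h1 : 0 < 1 - r ^ 2 := by nlinarith
  rw [hn, ← div_eq_mul_inv, le_div_iff₀ h1] at h
  nlinarith [mul_nonneg (mul_nonneg hr0.le (sub_nonneg.2 hr1.le))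
    (sq_nonneg ‖seriesEval F (r * u)‖)]

theorem tendsto_one_sub_mul_seriesEval {F : PowerSeries ℂ} (hF : F ∈ hardySeries) {u : ℂ}
    (hu : ‖u‖ = 1) :
    Filter.Tendsto (fun r : ℝ => (1 - r : ℂ) * seriesEval F (r * u)) (nhdsWithin 1 (Iio 1))
      (nhds 0) := by
  set M := ∑' n, ‖PowerSeries.coeff n F‖ ^ 2
  have hc : Continuous fun r : ℝ => √((1 - r) * M) := by fun_prop
  have h0 := (hc.tendsto 1).mono_left (nhdsWithin_le_nhds (s := Iio 1))
  simp only [sub_self, zero_mul, Real.sqrt_zero] at h0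
  refine squeeze_zero_norm' ?_ h0
  filter_upwards [Ioo_mem_nhdsLT (zero_lt_one' ℝ)] with r hr
  have h := one_sub_mul_norm_sq_seriesEval_le hF hu hr.1 hr.2
  have h1 : 0 < 1 - r := sub_pos.2 hr.2
  have hn : ‖(1 - r : ℂ)‖ = 1 - r := by
    rw [← Complex.ofReal_one, ← Complex.ofReal_sub, Complex.norm_of_nonneg h1.le]
  refine Real.le_sqrt_of_sq_le ?_
  rw [norm_mul, hn, mul_pow, sq (1 - r), mul_assoc]
  exact mul_le_mul_of_nonneg_left h h1.le

/-- A product of two `H²` functions times a polynomial vanishing at the point `u` of the unit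
circle is `o((1 - r)⁻¹)` along the radius to `u`. -/
theorem tendsto_one_sub_mul_eval_mul_seriesEval {F G : PowerSeries ℂ} (hF : F ∈ hardySeries)
    (hG : G ∈ hardySeries) {u : ℂ} (hu : ‖u‖ = 1) {p : Polynomial ℂ} (hp : p.IsRoot u) :
    Filter.Tendsto
      (fun r : ℝ => (1 - r : ℂ) * (p.eval (r * u) * seriesEval F (r * u) * seriesEval G (r * u)))
      (nhdsWithin 1 (Iio 1)) (nhds 0) := by
  set M := ∑' n, ‖PowerSeries.coeff n F‖ ^ 2
  set L := ∑' n, ‖PowerSeries.coeff n G‖ ^ 2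
  have hc : Continuous fun r : ℝ => ‖p.eval ((r : ℂ) * u)‖ * (M + L) := by fun_prop
  have h0 := (hc.tendsto 1).mono_left (nhdsWithin_le_nhds (s := Iio 1))
  simp only [Complex.ofReal_one, one_mul, hp.eq_zero, norm_zero, zero_mul] at h0
  refine squeeze_zero_norm' ?_ h0
  filter_upwards [Ioo_mem_nhdsLT (zero_lt_one' ℝ)] with r hr
  have hf := one_sub_mul_norm_sq_seriesEval_le hF hu hr.1 hr.2
  have hg := one_sub_mul_norm_sq_seriesEval_le hG hu hr.1 hr.2
  have h1 : 0 < 1 - r := sub_pos.2 hr.2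
  have hn : ‖(1 - r : ℂ)‖ = 1 - r := by
    rw [← Complex.ofReal_one, ← Complex.ofReal_sub, Complex.norm_of_nonneg h1.le]
  set x := ‖seriesEval F (r * u)‖
  set y := ‖seriesEval G (r * u)‖
  have hxy : (1 - r) * (x * y) ≤ M + L := by
    have : x * y ≤ x ^ 2 + y ^ 2 := by
      nlinarith [sq_nonneg (x - y), sq_nonneg (x + y), sq_nonneg x, sq_nonneg y]
    nlinarith [mul_le_mul_of_nonneg_left this h1.le]
  rw [norm_mul, norm_mul, norm_mul, hn]
  calc (1 - r) * (‖p.eval (r * u)‖ * x * y) = ‖p.eval (r * u)‖ * ((1 - r) * (x * y)) := by ring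
    _ ≤ _ := mul_le_mul_of_nonneg_left hxy (norm_nonneg _)

/-- for a polynomial `a` of degree `N` with all zeros on the unit
circle, the multipliers of `M(ā)` into itself are exactly `M(ā) ∩ H^∞`. -/
theorem stmt5 (N : ℕ) (ζ : Fin N → ℂ) (hζ : ∀ j, ‖ζ j‖ = 1) (φ : ℂ → ℂ) :
    Mult (fun z => ∏ j, (z - ζ j)) (fun z => ∏ j, (z - ζ j)) φ ↔
      MemMbar (fun z => ∏ j, (z - ζ j)) φ ∧ MemHinf φ := by
  have hev (z : ℂ) : (∏ j, (Polynomial.X - Polynomial.C (ζ j))).eval z = ∏ j, (z - ζ j) := by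
    rw [Polynomial.eval_prod]
    simp
  obtain ⟨hm, hn⟩ := monic_prod_X_sub ζ
  have hdA := Polynomial.degree_eq_natDegree hm.ne_zero
  rw [hn] at hdA
  have hiff := memMbar_iff ζ hζ
  set A := ∏ j, (Polynomial.X - Polynomial.C (ζ j))
  have hA0 : (A : PowerSeries ℂ) ≠ 0 := by
    rw [Ne, Polynomial.coe_eq_zero_iff]
    exact hm.ne_zero
  have hmod (p : Polynomial ℂ) : (p %ₘ A).degree < (N : ℕ) :=
    hdA ▸ Polynomial.degree_modByMonic_lt p hm
  have hdiv (p : Polynomial ℂ) :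
      ((p %ₘ A : Polynomial ℂ) : PowerSeries ℂ) + A * (p /ₘ A : Polynomial ℂ) = p := by
    rw [← Polynomial.coe_mul, ← Polynomial.coe_add, Polynomial.modByMonic_add_div]
  have hAKQ {K : PowerSeries ℂ} (hK : K ∈ hardySeries) (Q : Polynomial ℂ) :
      (A : PowerSeries ℂ) * K + Q ∈ hardySeries :=
    hardySeries.add_mem (polynomial_mul_mem_hardySeries _ hK) (polynomial_mem_hardySeries _)
  constructor
  · rintro ⟨hφ, hmult⟩
    have hφM : MemMbar (fun z => ∏ j, (z - ζ j)) φ := by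
      have h1 := hmult (fun _ => 1) ((hiff _).2 ⟨_, polynomial_mem_hardySeries (1 /ₘ A), _,
        hmod 1, fun z _ => by rw [add_comm, hdiv, seriesEval_coe, Polynomial.eval_one]⟩)
      simpa using h1
    refine ⟨hφM, hφ, ?_⟩
    obtain ⟨K₀, hK₀, Q₀, hQ₀, hφe⟩ := (hiff _).1 hφM
    have hΦmem := hAKQ hK₀ Q₀
    set Φ := (A : PowerSeries ℂ) * K₀ + Q₀ with hΦ
    have hΦc := convOnDisk_of_mem_hardySeries hΦmem
    obtain ⟨C, hC⟩ := exists_bound_of_mul_mem_hardySeries hΦc fun H hH => by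
      have hHc := convOnDisk_of_mem_hardySeries hH
      have hAH := polynomial_mul_mem_hardySeries A hH
      obtain ⟨K, hK, Q, hQ, h⟩ := (hiff _).1 (hmult (seriesEval (A * H))
        ((hiff _).2 ⟨H, hH, 0, by simp, fun z _ => by simp⟩))
      have hKc := convOnDisk_of_mem_hardySeries hK
      have heq : Φ * (A * H) = A * K + Q := by
        refine eq_of_seriesEval_eq (hΦc.mul (convOnDisk_of_mem_hardySeries hAH))
          (convOnDisk_of_mem_hardySeries (hAKQ hK Q)) fun z hz => ?_
        rw [seriesEval_mul hΦc (convOnDisk_of_mem_hardySeries hAH) hz,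
          ← hφe (mem_unitDisk.2 hz), ← h (mem_unitDisk.2 hz)]
      have hQ0 : Q = 0 := by
        refine eq_zero_of_eval_eq_prod_mul ζ hζ Q hQ
          (fun z => A.eval z * seriesEval K₀ z * seriesEval H z +
            seriesEval (Q₀ * H) z - seriesEval K z) (fun z hz => ?_) fun j => ?_
        · have hKc₀ := convOnDisk_of_mem_hardySeries hK₀
          have hz' := congrArg (fun S => seriesEval S z) heq
          rw [seriesEval_mul hΦc ((convOnDisk_coe A).mul hHc) hz, hΦ,
            seriesEval_add ((convOnDisk_coe A).mul hKc₀) (convOnDisk_coe Q₀) hz,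
            seriesEval_mul (convOnDisk_coe A) hHc hz, seriesEval_mul (convOnDisk_coe A) hKc₀ hz,
            seriesEval_add ((convOnDisk_coe A).mul hKc) (convOnDisk_coe Q) hz,
            seriesEval_mul (convOnDisk_coe A) hKc hz, seriesEval_coe, seriesEval_coe,
            seriesEval_coe] at hz'
          rw [seriesEval_mul (convOnDisk_coe Q₀) hHc hz, seriesEval_coe, ← hev]
          linear_combination -hz'
        · have hroot : A.IsRoot (ζ j) := by
            rw [Polynomial.IsRoot, hev]
            exact Finset.prod_eq_zero (Finset.mem_univ j) (sub_self _)
          have := ((tendsto_one_sub_mul_eval_mul_seriesEval hK₀ hH (hζ j) hroot).add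
            (tendsto_one_sub_mul_seriesEval (polynomial_mul_mem_hardySeries Q₀ hH) (hζ j))).sub
            (tendsto_one_sub_mul_seriesEval hK (hζ j))
          simpa [mul_add, mul_sub] using this
      have : Φ * H = K := by
        refine mul_left_cancel₀ hA0 ?_
        rw [hQ0, Polynomial.coe_zero, add_zero] at heq
        rw [← heq]
        ring
      rwa [this]
    refine ⟨C, fun z hz => ?_⟩
    rw [hφe hz]
    exact hC z (mem_unitDisk.1 hz)
  · rintro ⟨hφM, hφ, C, hC⟩
    refine ⟨hφ, fun f hf => ?_⟩
    obtain ⟨K₀, hK₀, Q₀, -, hφe⟩ := (hiff _).1 hφM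
    obtain ⟨K, hK, Q, -, hfe⟩ := (hiff _).1 hf
    have hΦc := convOnDisk_of_mem_hardySeries (hAKQ hK₀ Q₀)
    have hΦK := mul_mem_hardySeries_of_bounded hΦc hK (C := C) fun z hz => by
      rw [← hφe (mem_unitDisk.2 hz)]
      exact hC z (mem_unitDisk.2 hz)
    refine (hiff _).2 ⟨_, hardySeries.add_mem (hardySeries.add_mem hΦK
      (polynomial_mul_mem_hardySeries Q hK₀)) (polynomial_mem_hardySeries ((Q₀ * Q) /ₘ A)), _,
      hmod (Q₀ * Q), fun z hz => ?_⟩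
    have hd := hdiv (Q₀ * Q)
    rw [Polynomial.coe_mul] at hd
    change φ z * f z = _
    rw [hφe hz, hfe hz, ← seriesEval_mul hΦc (convOnDisk_of_mem_hardySeries (hAKQ hK Q))
      (mem_unitDisk.1 hz)]
    congr 1
    linear_combination -hd
end
end
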